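/- Let 1/3 < β < α < 1, let x : [0,2] → ℝ be α-Hölder, let σ : ℝ → ℝ be of class C² with σ, σ′, σ″ bounded, and let b : ℝ → ℝ be bounded and Lipschitz. Let y : [0,2] → ℝ be β-Hölder and let A be a β-Lévy area of order 0 associated with γ = (x, y). Then for every t ∈ [0,1] the corrected symmetric integral ∫_0^t σ(y(s)) d^{A,1}x(s) exists, and the function ỹ(t) = ∫_0^t σ(y(s)) d^{A,1}x(s) + ∫_0^t b(y(s)) ds satisfies |ỹ(t) − ỹ(s)| ≤ c (1 + |y|_β + |y|_β² + |y|_β |A|_{2β} + |A|_{2β}) |t − s|^β for all 0 ≤ s ≤ t ≤ 1, where c > 0 is a constant depending only on σ, b, x, α and β; in particular ỹ is β-Hölder on [0,1]. -/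

import Mathlib

open MeasureTheory Filter Set

/-- `z` is `α`-Hölder on the interval `[a, b]`. -/
def HolderOnIcc (α a b : ℝ) (z : ℝ → ℝ) : Prop :=
  ∃ L > 0, ∀ s ∈ Set.Icc a b, ∀ t ∈ Set.Icc a b, |z t - z s| ≤ L * |t - s| ^ α

/-- `A` is a `β`-Lévy area of order 0 associated with `γ = (x, y)` on `[0, 2]`. -/
def IsLevyArea0 (β : ℝ) (x y : ℝ → ℝ) (A : ℝ → ℝ → ℝ) : Prop :=
  (∀ r ∈ Set.Icc (0:ℝ) 2, ∀ s ∈ Set.Icc (0:ℝ) 2, ∀ t ∈ Set.Icc (0:ℝ) 2,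
    A r s + A s t + A t r
      = -(1/2) * ((y t - y s) * (x r - x s) - (y r - y s) * (x t - x s)))
  ∧ ∃ C > 0, ∀ s ∈ Set.Icc (0:ℝ) 2, ∀ t ∈ Set.Icc (0:ℝ) 2,
      |A s t| ≤ C * |t - s| ^ (2 * β)

/-- The `ε`-approximation `I_ε^{[a,b]}(f)` of the corrected symmetric integral. -/
noncomputable def Ieps (x y : ℝ → ℝ) (A : ℝ → ℝ → ℝ) (f : ℝ → ℝ) (a b ε : ℝ) : ℝ :=
  ε⁻¹ * (∫ u in a..b, ((f (y u) + f (y (u + ε))) / 2) * (x (u + ε) - x u))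
    + ε⁻¹ * (∫ u in a..b, deriv f (y u) * A u (u + ε))


/-- The `β`-Hölder seminorm `|z|_β` of `z` over `[0, 2]`. -/
noncomputable def holderNorm (β : ℝ) (z : ℝ → ℝ) : ℝ :=
  sSup {c : ℝ | ∃ s ∈ Set.Icc (0:ℝ) 2, ∃ t ∈ Set.Icc (0:ℝ) 2,
    s ≠ t ∧ c = |z t - z s| / |t - s| ^ β}

/-- The seminorm `|A|_{2β}` of a Lévy area `A` over `[0, 2]`. -/
noncomputable def areaNorm (β : ℝ) (A : ℝ → ℝ → ℝ) : ℝ :=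
  sSup {c : ℝ | ∃ s ∈ Set.Icc (0:ℝ) 2, ∃ t ∈ Set.Icc (0:ℝ) 2,
    s ≠ t ∧ c = |A s t| / |t - s| ^ (2 * β)}


lemma aux_grid (θ C K h : ℝ) (hθ : 1 < θ) (hC0 : 0 ≤ C) (hC : 2 + 2 * C * (1/2 : ℝ) ^ θ ≤ C)
    (hK : 0 ≤ K) (hh : 0 ≤ h) (N : ℕ) (X : ℕ → ℕ → ℝ) (hX0 : ∀ i, i ≤ N → X i i = 0)
    (hX : ∀ i j k, i ≤ j → j ≤ k → k ≤ N →
      |X i k - X i j - X j k| ≤ K * (((k:ℝ) - i) * h) ^ θ) :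
    ∀ n i j, j = i + n → j ≤ N →
      |X i j - ∑ k ∈ Finset.Ico i j, X k (k+1)| ≤ C * K * (((j:ℝ) - i) * h) ^ θ := by
  intro n
  induction n using Nat.strong_induction_on with
  | _ n ih =>
    intro i j hj hjN
    rcases Nat.eq_zero_or_pos n with hn | hn
    · subst hn
      have : j = i := by omega
      subst this
      simp [hX0 j hjN, Real.zero_rpow (by linarith : θ ≠ 0)]
    · obtain ⟨m, hm⟩ : ∃ m, m = n / 2 := ⟨_, rfl⟩
      obtain ⟨p, hp⟩ : ∃ p, p = i + m := ⟨_, rfl⟩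
      obtain ⟨q, hq⟩ : ∃ q, q = j - m := ⟨_, rfl⟩
      have hqj : j = q + m := by omega
      have hpq : q = p ∨ q = p + 1 := by omega
      have h1 := ih m (by omega) i p hp (by omega)
      have h2 := ih m (by omega) q j hqj hjN
      have h3 := hX i p j (by omega) (by omega) hjN
      have h4 := hX p q j (by omega) (by omega) hjN
      have hsum : ∑ k ∈ Finset.Ico i j, X k (k+1) = ∑ k ∈ Finset.Ico i p, X k (k+1)
          + X p q + ∑ k ∈ Finset.Ico q j, X k (k+1) := by
        rw [← Finset.sum_Ico_consecutive _ (show i ≤ p by omega) (show p ≤ j by omega),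
          ← Finset.sum_Ico_consecutive _ (show p ≤ q by omega) (show q ≤ j by omega)]
        rcases hpq with h | h
        · subst h
          simp [hX0 q (by omega)]
        · subst h
          simp; ring
      rw [hsum]
      set D := ((j:ℝ) - i) * h with hD
      have hmn : (m:ℝ) * 2 ≤ n := by
        have : m * 2 ≤ n := by omega
        exact_mod_cast this
      have hjr : (j:ℝ) = i + n := by rw [hj]; push_cast; ring
      have hpr : (p:ℝ) = i + m := by rw [hp]; push_cast; ring
      have hqr : (q:ℝ) = j - m := by rw [hqj]; push_cast; ring
      have hm0 : (0:ℝ) ≤ m := Nat.cast_nonneg m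
      have hDn : D = n * h := by rw [hD, hjr]; ring
      have hD0 : 0 ≤ D := by rw [hDn]; positivity
      have e1 : ((m:ℝ) * h) ^ θ ≤ (1/2:ℝ) ^ θ * D ^ θ := by
        rw [← Real.mul_rpow (by norm_num) hD0]
        apply Real.rpow_le_rpow (by positivity) _ (by linarith)
        rw [hDn]; nlinarith
      have e2 : (((j:ℝ) - p) * h) ^ θ ≤ D ^ θ := by
        apply Real.rpow_le_rpow
        · apply mul_nonneg _ hh
          rw [hjr, hpr]; nlinarith
        · rw [hDn, hjr, hpr]; nlinarith
        · linarith
      rw [hpr, add_sub_cancel_left] at h1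
      rw [hqr, sub_sub_cancel] at h2
      have hDθ : 0 ≤ D ^ θ := Real.rpow_nonneg hD0 _
      have h1' : C * K * ((m:ℝ) * h) ^ θ ≤ C * K * ((1/2:ℝ) ^ θ * D ^ θ) := by gcongr
      have h4' : K * (((j:ℝ) - p) * h) ^ θ ≤ K * D ^ θ := by gcongr
      have hfin : (2 + 2 * C * (1/2 : ℝ) ^ θ) * (K * D ^ θ) ≤ C * (K * D ^ θ) := by
        apply mul_le_mul_of_nonneg_right hC (by positivity)
      rw [abs_le] at *
      constructor <;> nlinarith

lemma aux_const (θ : ℝ) (hθ : 1 < θ) : ∃ C : ℝ, 0 ≤ C ∧ 2 + 2 * C * (1/2 : ℝ) ^ θ ≤ C := by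
  have h : (1/2 : ℝ) ^ θ < 1/2 := by
    have := Real.rpow_lt_rpow_of_exponent_gt (x := (1/2:ℝ)) (by norm_num) (by norm_num) hθ
    simpa using this
  have h2 : 0 < 1 - 2 * (1/2 : ℝ) ^ θ := by linarith
  refine ⟨2 / (1 - 2 * (1/2 : ℝ) ^ θ), by positivity, le_of_eq ?_⟩
  field_simp
  ring

lemma aux_sewing (θ : ℝ) (hθ : 1 < θ) : ∃ C : ℝ, 0 ≤ C ∧ ∀ (Ξ : ℝ → ℝ → ℝ) (K : ℝ), 0 ≤ K →
    ContinuousOn (fun p : ℝ × ℝ => Ξ p.1 p.2) (Icc 0 2 ×ˢ Icc 0 2) →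
    (∀ s ∈ Icc (0:ℝ) 2, Ξ s s = 0) →
    (∀ s u t, 0 ≤ s → s ≤ u → u ≤ t → t ≤ 2 → |Ξ s t - Ξ s u - Ξ u t| ≤ K * (t - s) ^ θ) →
    ∃ J : ℝ → ℝ, ∀ s t, 0 ≤ s → s ≤ t → t ≤ 2 → |J t - J s - Ξ s t| ≤ C * K * (t - s) ^ θ := by
  obtain ⟨C, hC0, hC⟩ := aux_const θ hθ
  refine ⟨C, hC0, fun Ξ K hK hcont h0 hδ => ?_⟩
  -- floor points
  let F : ℕ → ℝ → ℕ := fun n t => ⌊t * n⌋₊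
  let S : ℕ → ℝ → ℝ := fun n t => ∑ k ∈ Finset.Ico 0 (F n t), Ξ ((k:ℝ) / n) (((k+1:ℕ):ℝ) / n)
  have hFle : ∀ n t, 0 ≤ t → (F n t : ℝ) / n ≤ t := by
    intro n t ht
    rcases Nat.eq_zero_or_pos n with hn | hn
    · subst hn; simpa using ht
    · rw [div_le_iff₀ (by exact_mod_cast hn)]
      exact Nat.floor_le (by positivity)
  have hFmem : ∀ n t, t ∈ Icc (0:ℝ) 2 → (F n t : ℝ) / n ∈ Icc (0:ℝ) 2 := fun n t ht =>
    ⟨by positivity, (hFle n t ht.1).trans ht.2⟩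
  have hFlim : ∀ t, 0 ≤ t → Tendsto (fun n : ℕ => (F n t : ℝ) / n) atTop (nhds t) := by
    intro t ht
    exact (tendsto_nat_floor_mul_div_atTop ht).comp tendsto_natCast_atTop_atTop
  have hS : ∀ n s t, 0 ≤ s → s ≤ t → t ≤ 2 →
      |S n t - S n s - Ξ ((F n s : ℝ) / n) ((F n t : ℝ) / n)|
        ≤ C * K * ((F n t : ℝ) / n - (F n s : ℝ) / n) ^ θ := by
    intro n s t hs hst ht
    have hF : F n s ≤ F n t := Nat.floor_mono (by gcongr)
    have hmem : ∀ i, i ≤ F n t → ((i:ℝ) / n) ≤ 2 := fun i hi =>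
      le_trans (by gcongr) (hFmem n t ⟨hs.trans hst, ht⟩).2
    have hg := aux_grid θ C K (1 / n) hθ hC0 hC hK (by positivity) (F n t)
      (fun i j => Ξ ((i:ℝ) / n) ((j:ℝ) / n))
      (fun i hi => h0 _ ⟨by positivity, hmem i hi⟩)
      (fun i j k hij hjk hk => by
        have := hδ ((i:ℝ)/n) ((j:ℝ)/n) ((k:ℝ)/n) (by positivity) (by gcongr) (by gcongr) (hmem k hk)
        rwa [show ((k:ℝ) - i) * (1 / n) = (k:ℝ)/n - i/n by ring])
      (F n t - F n s) (F n s) (F n t) (by omega) le_rfl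
    have hsum : S n t - S n s
        = ∑ k ∈ Finset.Ico (F n s) (F n t), Ξ ((k:ℝ) / n) (((k+1:ℕ):ℝ) / n) := by
      simp only [S]
      rw [← Finset.sum_Ico_consecutive _ (Nat.zero_le (F n s)) hF]; ring
    rw [hsum, abs_sub_comm, show (F n t : ℝ) / n - (F n s : ℝ) / n
      = ((F n t:ℝ) - F n s) * (1 / n) by ring]
    exact hg
  let U : Ultrafilter ℕ := Ultrafilter.of atTop
  have hU : (U : Filter ℕ) ≤ atTop := Ultrafilter.of_le atTop
  have hΞlim : ∀ s t, s ∈ Icc (0:ℝ) 2 → t ∈ Icc (0:ℝ) 2 →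
      Tendsto (fun n => Ξ ((F n s : ℝ) / n) ((F n t : ℝ) / n)) U (nhds (Ξ s t)) := by
    intro s t hs ht
    have h1 := hcont (s, t) ⟨hs, ht⟩
    have h2 : Tendsto (fun n : ℕ => (((F n s : ℝ) / n), ((F n t : ℝ) / n))) atTop
        (nhdsWithin (s, t) (Icc 0 2 ×ˢ Icc 0 2)) := by
      apply tendsto_nhdsWithin_of_tendsto_nhds_of_eventually_within
      · exact (hFlim s hs.1).prodMk_nhds (hFlim t ht.1)
      · exact Eventually.of_forall fun n => ⟨hFmem n s hs, hFmem n t ht⟩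
    exact (h1.tendsto.comp h2).mono_left hU
  obtain ⟨B, hB⟩ : ∃ B, ∀ p ∈ (Icc (0:ℝ) 2 ×ˢ Icc (0:ℝ) 2), |Ξ p.1 p.2| ≤ B := by
    obtain ⟨B, hB⟩ := (isCompact_Icc.prod isCompact_Icc).exists_bound_of_continuousOn hcont
    exact ⟨B, fun p hp => hB p hp⟩
  have hlim : ∀ t, ∃ l, t ∈ Icc (0:ℝ) 2 → Tendsto (fun n => S n t) U (nhds l) := by
    intro t
    by_cases ht : t ∈ Icc (0:ℝ) 2
    swap
    · exact ⟨0, fun h => absurd h ht⟩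
    have hbd : ∀ n, S n t ∈ Icc (-(B + C * K * 2 ^ θ)) (B + C * K * 2 ^ θ) := by
      intro n
      have h1 := hS n 0 t le_rfl ht.1 ht.2
      have hF0 : F n 0 = 0 := by simp [F]
      have hS0 : S n 0 = 0 := by simp [S, hF0]
      rw [hS0, hF0] at h1
      simp only [Nat.cast_zero, zero_div, sub_zero] at h1
      have h2 := hB (0, (F n t : ℝ)/n) ⟨⟨le_rfl, by norm_num⟩, hFmem n t ht⟩
      have h3 : C * K * ((F n t : ℝ)/n) ^ θ ≤ C * K * 2 ^ θ := by
        have := (hFmem n t ht).2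
        gcongr
      rw [mem_Icc, ← abs_le]
      rw [abs_le] at *
      constructor <;> linarith [h1.1, h1.2, h2.1, h2.2]
    obtain ⟨l, -, hl⟩ := (isCompact_Icc (a := -(B + C * K * 2 ^ θ))
      (b := B + C * K * 2 ^ θ)).ultrafilter_le_nhds (U.map fun n => S n t) (by
        rw [Ultrafilter.coe_map, le_principal_iff]
        exact Filter.mem_map.2 (Eventually.of_forall hbd))
    exact ⟨l, fun _ => hl⟩
  choose J hJ using hlim
  refine ⟨J, fun s t hs hst ht => ?_⟩
  have hsm : s ∈ Icc (0:ℝ) 2 := ⟨hs, hst.trans ht⟩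
  have htm : t ∈ Icc (0:ℝ) 2 := ⟨hs.trans hst, ht⟩
  have l1 := (((hJ t htm).sub (hJ s hsm)).sub (hΞlim s t hsm htm)).abs
  have l2 : Tendsto (fun n => C * K * ((F n t : ℝ) / n - (F n s : ℝ) / n) ^ θ) U
      (nhds (C * K * (t - s) ^ θ)) := by
    have := ((hFlim t htm.1).sub (hFlim s hs)).mono_left hU
    exact (this.rpow_const (Or.inr (by linarith))).const_mul _
  exact le_of_tendsto_of_tendsto' l1 l2 (fun n => hS n s t hs hst ht)

lemma aux_contOn (α L : ℝ) (hα : 0 < α) (z : ℝ → ℝ)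
    (hz : ∀ s ∈ Icc (0:ℝ) 2, ∀ t ∈ Icc (0:ℝ) 2, |z t - z s| ≤ L * |t - s| ^ α) :
    ContinuousOn z (Icc 0 2) := by
  intro s hs
  rw [ContinuousWithinAt, tendsto_iff_dist_tendsto_zero]
  have hlim : Tendsto (fun t : ℝ => L * |t - s| ^ α) (nhdsWithin s (Icc 0 2)) (nhds 0) := by
    have hc : Continuous (fun t : ℝ => L * |t - s| ^ α) := by
      apply Continuous.mul continuous_const
      exact Continuous.rpow_const (by fun_prop) (fun _ => Or.inr hα.le)
    have := hc.tendsto s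
    simp only [sub_self, abs_zero, Real.zero_rpow hα.ne', mul_zero] at this
    exact this.mono_left nhdsWithin_le_nhds
  refine squeeze_zero' (Eventually.of_forall fun _ => dist_nonneg) ?_ hlim
  filter_upwards [self_mem_nhdsWithin] with t ht
  rw [Real.dist_eq]
  exact hz s hs t ht

lemma aux_sSup (p : ℝ) (G : ℝ → ℝ → ℝ) (h0 : ∀ s ∈ Icc (0:ℝ) 2, G s s = 0)
    (hb : ∃ L > 0, ∀ s ∈ Icc (0:ℝ) 2, ∀ t ∈ Icc (0:ℝ) 2, |G s t| ≤ L * |t - s| ^ p) :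
    0 ≤ sSup {c : ℝ | ∃ s ∈ Icc (0:ℝ) 2, ∃ t ∈ Icc (0:ℝ) 2,
      s ≠ t ∧ c = |G s t| / |t - s| ^ p} ∧
    ∀ s ∈ Icc (0:ℝ) 2, ∀ t ∈ Icc (0:ℝ) 2, |G s t| ≤
      sSup {c : ℝ | ∃ s ∈ Icc (0:ℝ) 2, ∃ t ∈ Icc (0:ℝ) 2,
      s ≠ t ∧ c = |G s t| / |t - s| ^ p} * |t - s| ^ p := by
  have hnn : 0 ≤ sSup {c : ℝ | ∃ s ∈ Icc (0:ℝ) 2, ∃ t ∈ Icc (0:ℝ) 2,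
      s ≠ t ∧ c = |G s t| / |t - s| ^ p} := by
    apply Real.sSup_nonneg
    rintro c ⟨s, -, t, -, -, rfl⟩
    positivity
  refine ⟨hnn, fun s hs t ht => ?_⟩
  by_cases hst : s = t
  · subst hst
    rw [h0 s hs, abs_zero]
    exact mul_nonneg hnn (by positivity)
  · have hpos : 0 < |t - s| ^ p := Real.rpow_pos_of_pos (abs_pos.2 (sub_ne_zero.2 (Ne.symm hst))) _
    rw [← div_le_iff₀ hpos]
    apply le_csSup
    · obtain ⟨L, -, hL⟩ := hb
      refine ⟨L, ?_⟩
      rintro c ⟨s, hs, t, ht, hst, rfl⟩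
      have hpos : 0 < |t - s| ^ p :=
        Real.rpow_pos_of_pos (abs_pos.2 (sub_ne_zero.2 (Ne.symm hst))) _
      rw [div_le_iff₀ hpos]
      exact hL s hs t ht
    · exact ⟨s, hs, t, ht, hst, rfl⟩

lemma aux_lip (f : ℝ → ℝ) (hf : Differentiable ℝ f) (M : ℝ) (hM : ∀ z, |deriv f z| ≤ M) (a b : ℝ) :
    |f b - f a| ≤ M * |b - a| := by
  have := Convex.norm_image_sub_le_of_norm_deriv_le (s := univ) (f := f) (C := M)
    (fun z _ => hf z) (fun z _ => hM z) convex_univ (mem_univ a) (mem_univ b)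
  simpa using this

lemma aux_taylor (f : ℝ → ℝ) (hf : ContDiff ℝ 2 f) (M : ℝ) (hM : ∀ z, |deriv (deriv f) z| ≤ M)
    (a b : ℝ) : |f b - f a - deriv f a * (b - a)| ≤ M * |b - a| ^ 2 := by
  have hM0 : 0 ≤ M := (abs_nonneg _).trans (hM 0)
  have hd : Differentiable ℝ f := hf.differentiable (by norm_num)
  have hd2 : Differentiable ℝ (deriv f) := by
    have : ContDiff ℝ (1 + 1) f := by simpa [one_add_one_eq_two] using hf
    exact ((contDiff_succ_iff_deriv.1 this).2.2).differentiable (by norm_num)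
  have key : ∀ z ∈ uIcc a b, ‖deriv (fun w => f w - deriv f a * w) z‖ ≤ M * |b - a| := by
    intro z hz
    have : deriv (fun w => f w - deriv f a * w) z = deriv f z - deriv f a := by
      have h1 : HasDerivAt (fun w => f w - deriv f a * w) (deriv f z - deriv f a * 1) z :=
        (hd z).hasDerivAt.sub ((hasDerivAt_id z).const_mul _)
      simpa using h1.deriv
    rw [this, Real.norm_eq_abs]
    refine (aux_lip _ hd2 M hM a z).trans ?_
    exact mul_le_mul_of_nonneg_left (abs_sub_left_of_mem_uIcc hz) hM0
  have := Convex.norm_image_sub_le_of_norm_deriv_le (f := fun w => f w - deriv f a * w)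
    (fun z _ => by fun_prop) key (convex_uIcc a b) left_mem_uIcc right_mem_uIcc
  rw [Real.norm_eq_abs, Real.norm_eq_abs] at this
  calc _ = |f b - deriv f a * b - (f a - deriv f a * a)| := by congr 1; ring
    _ ≤ _ := this
    _ = _ := by ring

lemma aux_pow (p β d : ℝ) (h1 : β ≤ p) (h2 : p ≤ β + 2) (hβ : 0 < β) (hd0 : 0 ≤ d) (hd : d ≤ 2) :
    d ^ p ≤ 4 * d ^ β := by
  rcases hd0.eq_or_lt with h | h
  · subst h
    rw [Real.zero_rpow (by linarith), Real.zero_rpow hβ.ne']; norm_num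
  · have : d ^ p = d ^ (p - β) * d ^ β := by rw [← Real.rpow_add h]; congr 1; ring
    rw [this]
    apply mul_le_mul_of_nonneg_right _ (by positivity)
    calc d ^ (p - β) ≤ 2 ^ (p - β) := Real.rpow_le_rpow hd0 hd (by linarith)
      _ ≤ 2 ^ (2:ℝ) := Real.rpow_le_rpow_of_exponent_le (by norm_num) (by linarith)
      _ = 4 := by norm_num

lemma aux_area_diag (β : ℝ) (x y : ℝ → ℝ) (A : ℝ → ℝ → ℝ) (hA : IsLevyArea0 β x y A) :
    ∀ s ∈ Icc (0:ℝ) 2, A s s = 0 := by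
  intro s hs
  have := hA.1 s hs s hs s hs
  linarith

lemma aux_area_anti (β : ℝ) (x y : ℝ → ℝ) (A : ℝ → ℝ → ℝ) (hA : IsLevyArea0 β x y A) :
    ∀ s ∈ Icc (0:ℝ) 2, ∀ t ∈ Icc (0:ℝ) 2, A t s = - A s t := by
  intro s hs t ht
  have := hA.1 s hs s hs t ht
  have h0 := aux_area_diag β x y A hA s hs
  linarith

lemma aux_area_cont (β : ℝ) (hβ : 0 < β) (x y : ℝ → ℝ) (A : ℝ → ℝ → ℝ) (hA : IsLevyArea0 β x y A)
    (hx : ContinuousOn x (Icc 0 2)) (hy : ContinuousOn y (Icc 0 2)) :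
    ContinuousOn (fun p : ℝ × ℝ => A p.1 p.2) (Icc 0 2 ×ˢ Icc 0 2) := by
  have h0m : (0:ℝ) ∈ Icc (0:ℝ) 2 := by constructor <;> norm_num
  have hrep : ∀ s ∈ Icc (0:ℝ) 2, ∀ t ∈ Icc (0:ℝ) 2, A s t = A 0 t - A 0 s
      + -(1/2) * ((y t - y s) * (x 0 - x s) - (y 0 - y s) * (x t - x s)) := by
    intro s hs t ht
    have h1 := hA.1 0 h0m s hs t ht
    have h2 := aux_area_anti β x y A hA 0 h0m t ht
    linarith
  have hh : ContinuousOn (fun t => A 0 t) (Icc 0 2) := by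
    intro s hs
    obtain ⟨C, hC, hAC⟩ := hA.2
    have h1 : Tendsto (fun t => A s t) (nhdsWithin s (Icc 0 2)) (nhds 0) := by
      have hlim : Tendsto (fun t : ℝ => C * |t - s| ^ (2 * β)) (nhdsWithin s (Icc 0 2))
          (nhds 0) := by
        have hc : Continuous (fun t : ℝ => C * |t - s| ^ (2 * β)) := by
          apply Continuous.mul continuous_const
          exact Continuous.rpow_const (by fun_prop) (fun _ => Or.inr (by linarith))
        have := hc.tendsto s
        simp only [sub_self, abs_zero, Real.zero_rpow (by linarith : 2 * β ≠ 0), mul_zero] at this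
        exact this.mono_left nhdsWithin_le_nhds
      refine squeeze_zero_norm' ?_ hlim
      filter_upwards [self_mem_nhdsWithin] with t ht
      exact hAC s hs t ht
    have hxs : Tendsto x (nhdsWithin s (Icc 0 2)) (nhds (x s)) := hx s hs
    have hys : Tendsto y (nhdsWithin s (Icc 0 2)) (nhds (y s)) := hy s hs
    have h2 := (h1.add_const (A 0 s)).sub
      ((((hys.sub_const (y s)).mul_const (x 0 - x s)).sub
        ((hxs.sub_const (x s)).const_mul (y 0 - y s))).const_mul (-(1/2)))
    simp only [sub_self, zero_mul, mul_zero, sub_zero, zero_add] at h2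
    refine h2.congr' ?_
    filter_upwards [self_mem_nhdsWithin] with t ht
    rw [hrep s hs t ht]; ring
  have hm1 : MapsTo (fun p : ℝ × ℝ => p.1) (Icc (0:ℝ) 2 ×ˢ Icc (0:ℝ) 2) (Icc 0 2) :=
    fun p hp => hp.1
  have hm2 : MapsTo (fun p : ℝ × ℝ => p.2) (Icc (0:ℝ) 2 ×ˢ Icc (0:ℝ) 2) (Icc 0 2) :=
    fun p hp => hp.2
  have hx1 := hx.comp continuousOn_fst hm1
  have hx2 := hx.comp continuousOn_snd hm2
  have hy1 := hy.comp continuousOn_fst hm1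
  have hy2 := hy.comp continuousOn_snd hm2
  have hh1 := hh.comp continuousOn_fst hm1
  have hh2 := hh.comp continuousOn_snd hm2
  have := (hh2.sub hh1).add ((((hy2.sub hy1).mul (continuousOn_const (c := x 0) |>.sub hx1)).sub
    ((continuousOn_const (c := y 0) |>.sub hy1).mul (hx2.sub hx1))).const_smul (-(1/2):ℝ))
  refine this.congr ?_
  intro p hp
  change A p.1 p.2 = _
  rw [hrep p.1 hp.1 p.2 hp.2]
  simp

/-- averaging lemma -/
lemma aux_avg (J : ℝ → ℝ) (hJ : Continuous J) (t : ℝ) :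
    Tendsto (fun ε : ℝ => ε⁻¹ * ∫ u in (0:ℝ)..t, (J (u + ε) - J u)) (nhdsWithin 0 (Ioi 0))
      (nhds (J t - J 0)) := by
  have hJint : ∀ a b, IntervalIntegrable J volume a b := fun a b => hJ.intervalIntegrable a b
  have hd : ∀ a, Tendsto (fun ε : ℝ => ε⁻¹ • ((∫ u in (0:ℝ)..(a+ε), J u) - ∫ u in (0:ℝ)..a, J u))
      (nhdsWithin 0 (Ioi 0)) (nhds (J a)) := by
    intro a
    have := (hJ.integral_hasStrictDerivAt 0 a).hasDerivAt
    rw [hasDerivAt_iff_tendsto_slope_zero] at this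
    exact this.mono_left (nhdsWithin_mono _ fun z hz => ne_of_gt hz)
  refine ((hd t).sub (hd 0)).congr fun ε => ?_
  have hsh : IntervalIntegrable (fun u => J (u + ε)) volume 0 t :=
    (hJ.comp (continuous_add_const ε)).intervalIntegrable _ _
  rw [intervalIntegral.integral_sub hsh (hJint _ _),
    intervalIntegral.integral_comp_add_right]
  have h1 := intervalIntegral.integral_add_adjacent_intervals (hJint 0 (0+ε)) (hJint (0+ε) (t+ε))
  rw [← h1]
  simp only [smul_eq_mul, intervalIntegral.integral_same]
  ring

lemma aux_delta (fs fu ft p p' xs xu xt ys yu yt ast asu aut M N Q L d2 da d3 d1 : ℝ)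
    (hA : ast - asu - aut = (1/2) * ((yt - yu) * (xs - xu) - (ys - yu) * (xt - xu)))
    (hRu : |fu - fs - p * (yu - ys)| ≤ M * N ^ 2 * d2)
    (hRt : |ft - fs - p * (yt - ys)| ≤ M * N ^ 2 * d2)
    (h1 : |xt - xs| ≤ L * da) (h2 : |xu - xs| ≤ L * da) (h3 : |xt - xu| ≤ L * da)
    (hp : |p' - p| ≤ M * N * d1) (ha : |aut| ≤ Q * d2)
    (e1 : d2 * da ≤ 4 * d3) (e2 : d1 * d2 = d3) (hM : 0 ≤ M) (hL : 0 ≤ L) :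
    |((fs + ft) / 2 * (xt - xs) + p * ast) - ((fs + fu) / 2 * (xu - xs) + p * asu)
      - ((fu + ft) / 2 * (xt - xu) + p' * aut)| ≤ (8 * M * L * N ^ 2 + M * N * Q) * d3 := by
  have hid : ((fs + ft) / 2 * (xt - xs) + p * ast) - ((fs + fu) / 2 * (xu - xs) + p * asu)
      - ((fu + ft) / 2 * (xt - xu) + p' * aut)
      = (1/2) * ((ft - fs - p * (yt - ys)) * (xt - xs)) - (1/2) * ((fu - fs - p * (yu - ys)) * (xu - xs))
        - (1/2) * ((fu - fs - p * (yu - ys)) * (xt - xu))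
        - (1/2) * ((ft - fs - p * (yt - ys)) * (xt - xu)) - (p' - p) * aut := by
    have : ast = asu + aut + (1/2) * ((yt - yu) * (xs - xu) - (ys - yu) * (xt - xu)) := by linarith
    rw [this]; ring
  rw [hid]
  have hprod : ∀ a b A B : ℝ, |a| ≤ A → |b| ≤ B → |a * b| ≤ A * B := by
    intro a b A B h1 h2
    rw [abs_mul]
    exact mul_le_mul h1 h2 (abs_nonneg _) ((abs_nonneg _).trans h1)
  have k1 := hprod _ _ _ _ hRt h1
  have k2 := hprod _ _ _ _ hRu h2
  have k3 := hprod _ _ _ _ hRu h3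
  have k4 := hprod _ _ _ _ hRt h3
  have k5 := hprod _ _ _ _ hp ha
  have e3 : M * N ^ 2 * d2 * (L * da) ≤ 4 * M * L * N ^ 2 * d3 := by
    have : M * L * N ^ 2 * (d2 * da) ≤ M * L * N ^ 2 * (4 * d3) := by gcongr
    linarith
  have e4 : M * N * d1 * (Q * d2) = M * N * Q * d3 := by rw [← e2]; ring
  rw [abs_le] at *
  constructor <;> linarith [k1.1, k1.2, k2.1, k2.2, k3.1, k3.2, k4.1, k4.2, k5.1, k5.2]

/-- Convergence of the averages of a germ which is close to an increment. -/
lemma aux_limit (Ξ : ℝ → ℝ → ℝ) (J : ℝ → ℝ) (H θ : ℝ) (hθ : 1 < θ) (hH : 0 ≤ H)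
    (hΞ : ContinuousOn (fun p : ℝ × ℝ => Ξ p.1 p.2) (Icc 0 2 ×ˢ Icc 0 2))
    (hJc : ContinuousOn J (Icc 0 2))
    (hJ : ∀ s t, 0 ≤ s → s ≤ t → t ≤ 2 → |J t - J s - Ξ s t| ≤ H * (t - s) ^ θ)
    (t : ℝ) (ht0 : 0 ≤ t) (ht1 : t ≤ 1) :
    Tendsto (fun ε : ℝ => ε⁻¹ * ∫ u in (0:ℝ)..t, Ξ u (u + ε)) (nhdsWithin 0 (Ioi 0))
      (nhds (J t - J 0)) := by
  let Jc : ℝ → ℝ := fun u => J (max 0 (min 2 u))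
  have hJcc : Continuous Jc := by
    apply hJc.comp_continuous (by fun_prop)
    intro u
    exact ⟨le_max_left _ _, max_le (by norm_num) (min_le_left _ _)⟩
  have hJe : ∀ u, 0 ≤ u → u ≤ 2 → Jc u = J u := by
    intro u h0 h2
    simp only [Jc, min_eq_right h2, max_eq_right h0]
  have h1 := aux_avg Jc hJcc t
  rw [hJe t ht0 (by linarith), hJe 0 le_rfl (by norm_num)] at h1
  have h2 : Tendsto (fun ε : ℝ => ε⁻¹ * (∫ u in (0:ℝ)..t, Ξ u (u + ε))
      - ε⁻¹ * ∫ u in (0:ℝ)..t, (Jc (u + ε) - Jc u)) (nhdsWithin 0 (Ioi 0)) (nhds 0) := by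
    have hlim : Tendsto (fun ε : ℝ => H * ε ^ (θ - 1)) (nhdsWithin 0 (Ioi 0)) (nhds 0) := by
      have hc : Continuous (fun ε : ℝ => H * ε ^ (θ - 1)) :=
        continuous_const.mul (Continuous.rpow_const continuous_id (fun _ => Or.inr (by linarith)))
      have := hc.tendsto 0
      simp only [Real.zero_rpow (by linarith : θ - 1 ≠ 0), mul_zero] at this
      exact this.mono_left nhdsWithin_le_nhds
    refine squeeze_zero_norm' ?_ hlim
    filter_upwards [Ioc_mem_nhdsGT (show (0:ℝ) < 1 by norm_num)] with ε hε
    have hε0 : 0 < ε := hε.1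
    have i1 : IntervalIntegrable (fun u => Ξ u (u + ε)) volume 0 t := by
      apply ContinuousOn.intervalIntegrable
      rw [uIcc_of_le ht0]
      refine hΞ.comp (f := fun u : ℝ => (u, u + ε)) (by fun_prop) ?_
      intro u hu
      exact ⟨⟨hu.1, by linarith [hu.2]⟩, ⟨by linarith [hu.1], by linarith [hu.2, hε.2]⟩⟩
    have i2 : IntervalIntegrable (fun u => Jc (u + ε) - Jc u) volume 0 t := by
      apply Continuous.intervalIntegrable
      fun_prop
    rw [← mul_sub, ← intervalIntegral.integral_sub i1 i2, norm_mul, norm_inv,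
      Real.norm_of_nonneg hε0.le]
    have hb := intervalIntegral.norm_integral_le_of_norm_le_const (a := 0) (b := t)
      (f := fun u => Ξ u (u + ε) - (Jc (u + ε) - Jc u)) (C := H * ε ^ θ) (by
        intro u hu
        rw [uIoc_of_le ht0] at hu
        have hu0 := hu.1
        have hu2 := hu.2
        have hε2 := hε.2
        rw [hJe u (by linarith) (by linarith), hJe (u+ε) (by linarith) (by linarith),
          Real.norm_eq_abs, abs_sub_comm]
        have := hJ u (u+ε) (by linarith) (by linarith) (by linarith)
        rwa [add_sub_cancel_left] at this)
    rw [sub_zero, abs_of_nonneg ht0] at hb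
    have hp : ε ^ (θ - 1) = ε⁻¹ * ε ^ θ := by
      rw [Real.rpow_sub hε0, Real.rpow_one]; ring
    rw [hp]
    have hpos : 0 ≤ H * ε ^ θ := by positivity
    calc _ ≤ ε⁻¹ * (H * ε ^ θ * t) := by gcongr
      _ ≤ ε⁻¹ * (H * ε ^ θ * 1) := by gcongr
      _ = _ := by ring
  have := h2.add h1
  simpa using this

theorem stmt_15 (α β : ℝ) (hβ : 1/3 < β) (hβα : β < α) (hα : α < 1)
    (x : ℝ → ℝ) (hx : HolderOnIcc α 0 2 x)
    (σ : ℝ → ℝ) (hσ : ContDiff ℝ 2 σ)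
    (hσbdd : ∃ M : ℝ, ∀ z : ℝ, |σ z| ≤ M ∧ |deriv σ z| ≤ M ∧ |deriv (deriv σ) z| ≤ M)
    (b : ℝ → ℝ) (hblip : ∃ K : NNReal, LipschitzWith K b)
    (hbbdd : ∃ M : ℝ, ∀ z : ℝ, |b z| ≤ M) :
    ∃ c > 0, ∀ (y : ℝ → ℝ) (A : ℝ → ℝ → ℝ),
      HolderOnIcc β 0 2 y → IsLevyArea0 β x y A →
      ∃ g : ℝ → ℝ,
        (∀ t ∈ Set.Icc (0:ℝ) 1,
          Filter.Tendsto (fun ε => Ieps x y A σ 0 t ε) (nhdsWithin 0 (Set.Ioi 0))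
            (nhds (g t))) ∧
        ∀ s t : ℝ, 0 ≤ s → s ≤ t → t ≤ 1 →
          |(g t + ∫ w in (0:ℝ)..t, b (y w)) - (g s + ∫ w in (0:ℝ)..s, b (y w))|
            ≤ c * (1 + holderNorm β y + holderNorm β y ^ 2
                + holderNorm β y * areaNorm β A + areaNorm β A) * (t - s) ^ β := by
  obtain ⟨L, hL, hxL⟩ := hx
  obtain ⟨M, hM⟩ := hσbdd
  obtain ⟨B, hB⟩ := hbbdd
  obtain ⟨Kb, hKb⟩ := hblip
  obtain ⟨C, hC0, hsew⟩ := aux_sewing (3 * β) (by linarith)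
  have hM0 : 0 ≤ M := (abs_nonneg _).trans (hM 0).1
  have hB0 : 0 ≤ B := (abs_nonneg _).trans (hB 0)
  have hβ0 : 0 < β := by linarith
  refine ⟨4 * (M * L + M + C * (8 * M * L + M) + B) + 1, by positivity, ?_⟩
  intro y A hy hA
  have hxc : ContinuousOn x (Icc 0 2) := aux_contOn α L (by linarith) x hxL
  have hyc : ContinuousOn y (Icc 0 2) := by
    obtain ⟨Ly, -, h⟩ := hy
    exact aux_contOn β Ly hβ0 y h
  have hAc := aux_area_cont β hβ0 x y A hA hxc hyc
  obtain ⟨hN0, hN⟩ : 0 ≤ holderNorm β y ∧ ∀ s ∈ Icc (0:ℝ) 2, ∀ t ∈ Icc (0:ℝ) 2,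
      |y t - y s| ≤ holderNorm β y * |t - s| ^ β :=
    aux_sSup β (fun s t => y t - y s) (fun s _ => sub_self _) hy
  obtain ⟨hQ0, hQ⟩ : 0 ≤ areaNorm β A ∧ ∀ s ∈ Icc (0:ℝ) 2, ∀ t ∈ Icc (0:ℝ) 2,
      |A s t| ≤ areaNorm β A * |t - s| ^ (2 * β) :=
    aux_sSup (2 * β) A (aux_area_diag β x y A hA) hA.2
  generalize holderNorm β y = N at *
  generalize areaNorm β A = Q at *
  have hσd : Differentiable ℝ σ := hσ.differentiable (by norm_num)
  have hσd2 : Differentiable ℝ (deriv σ) := by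
    have : ContDiff ℝ (1 + 1) σ := by simpa [one_add_one_eq_two] using hσ
    exact ((contDiff_succ_iff_deriv.1 this).2.2).differentiable (by norm_num)
  have hσc := hσd.continuous
  have hσc2 := hσd2.continuous
  let Ξ : ℝ → ℝ → ℝ := fun s t =>
    (σ (y s) + σ (y t)) / 2 * (x t - x s) + deriv σ (y s) * A s t
  have hm1 : MapsTo (fun p : ℝ × ℝ => p.1) (Icc (0:ℝ) 2 ×ˢ Icc (0:ℝ) 2) (Icc 0 2) :=
    fun p hp => hp.1
  have hm2 : MapsTo (fun p : ℝ × ℝ => p.2) (Icc (0:ℝ) 2 ×ˢ Icc (0:ℝ) 2) (Icc 0 2) :=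
    fun p hp => hp.2
  have hx1 : ContinuousOn (fun p : ℝ × ℝ => x p.1) (Icc (0:ℝ) 2 ×ˢ Icc (0:ℝ) 2) :=
    hxc.comp continuousOn_fst hm1
  have hx2 : ContinuousOn (fun p : ℝ × ℝ => x p.2) (Icc (0:ℝ) 2 ×ˢ Icc (0:ℝ) 2) :=
    hxc.comp continuousOn_snd hm2
  have hy1 : ContinuousOn (fun p : ℝ × ℝ => y p.1) (Icc (0:ℝ) 2 ×ˢ Icc (0:ℝ) 2) :=
    hyc.comp continuousOn_fst hm1
  have hy2 : ContinuousOn (fun p : ℝ × ℝ => y p.2) (Icc (0:ℝ) 2 ×ˢ Icc (0:ℝ) 2) :=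
    hyc.comp continuousOn_snd hm2
  have hs1 := hσc.comp_continuousOn hy1
  have hs2 := hσc.comp_continuousOn hy2
  have hs3 := hσc2.comp_continuousOn hy1
  have hT1 : ContinuousOn (fun p : ℝ × ℝ => (σ (y p.1) + σ (y p.2)) / 2 * (x p.2 - x p.1))
      (Icc 0 2 ×ˢ Icc 0 2) := ((hs1.add hs2).div_const 2).mul (hx2.sub hx1)
  have hT2 : ContinuousOn (fun p : ℝ × ℝ => deriv σ (y p.1) * A p.1 p.2)
      (Icc 0 2 ×ˢ Icc 0 2) := hs3.mul hAc
  have hΞc : ContinuousOn (fun p : ℝ × ℝ => Ξ p.1 p.2) (Icc 0 2 ×ˢ Icc 0 2) := hT1.add hT2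
  have hΞ0 : ∀ s ∈ Icc (0:ℝ) 2, Ξ s s = 0 := by
    intro s hs
    simp [Ξ, aux_area_diag β x y A hA s hs]
  set K := 8 * M * L * N ^ 2 + M * N * Q with hK
  have hK0 : 0 ≤ K := by positivity
  have hδ : ∀ s u t, 0 ≤ s → s ≤ u → u ≤ t → t ≤ 2 →
      |Ξ s t - Ξ s u - Ξ u t| ≤ K * (t - s) ^ (3 * β) := by
    intro s u t hs hsu hut ht
    have hsm : s ∈ Icc (0:ℝ) 2 := ⟨hs, by linarith⟩
    have hum : u ∈ Icc (0:ℝ) 2 := ⟨by linarith, by linarith⟩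
    have htm : t ∈ Icc (0:ℝ) 2 := ⟨by linarith, by linarith⟩
    have hd0 : 0 ≤ t - s := by linarith
    have hd2 : t - s ≤ 2 := by linarith
    have mono : ∀ p : ℝ, 0 ≤ p → ∀ v w : ℝ, s ≤ v → v ≤ w → w ≤ t → |w - v| ^ p ≤ (t - s) ^ p := by
      intro p hp v w h1 h2 h3
      rw [abs_of_nonneg (by linarith)]
      exact Real.rpow_le_rpow (by linarith) (by linarith) hp
    have hyb : ∀ v w, s ≤ v → v ≤ w → w ≤ t → |y w - y v| ≤ N * (t - s) ^ β := by
      intro v w h1 h2 h3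
      refine (hN v ⟨by linarith, by linarith⟩ w ⟨by linarith, by linarith⟩).trans ?_
      exact mul_le_mul_of_nonneg_left (mono β hβ0.le v w h1 h2 h3) hN0
    have hxb : ∀ v w, s ≤ v → v ≤ w → w ≤ t → |x w - x v| ≤ L * (t - s) ^ α := by
      intro v w h1 h2 h3
      refine (hxL v ⟨by linarith, by linarith⟩ w ⟨by linarith, by linarith⟩).trans ?_
      exact mul_le_mul_of_nonneg_left (mono α (by linarith) v w h1 h2 h3) hL.le
    have hR : ∀ w, s ≤ w → w ≤ t → |σ (y w) - σ (y s) - deriv σ (y s) * (y w - y s)|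
        ≤ M * N ^ 2 * (t - s) ^ (2 * β) := by
      intro w h1 h2
      refine (aux_taylor σ hσ M (fun z => (hM z).2.2) (y s) (y w)).trans ?_
      have h3 := hyb s w le_rfl h1 h2
      have h4 : (t - s) ^ (2 * β) = ((t - s) ^ β) ^ 2 := by
        rw [mul_comm, Real.rpow_mul hd0]; norm_num
      rw [h4, mul_assoc, ← mul_pow]
      gcongr
    refine aux_delta (σ (y s)) (σ (y u)) (σ (y t)) (deriv σ (y s)) (deriv σ (y u)) (x s) (x u) (x t)
      (y s) (y u) (y t) (A s t) (A s u) (A u t) M N Q L ((t-s)^(2*β)) ((t-s)^α) ((t-s)^(3*β))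
      ((t-s)^β) ?_ (hR u hsu hut) (hR t (by linarith) le_rfl) (hxb s t le_rfl (by linarith) le_rfl)
      (hxb s u le_rfl hsu hut) (hxb u t hsu hut le_rfl) ?_ ?_ ?_ ?_ hM0 hL.le
    · have h1 := hA.1 s hsm u hum t htm
      have h2 := aux_area_anti β x y A hA s hsm t htm
      linarith
    · refine (aux_lip _ hσd2 M (fun z => (hM z).2.2) (y s) (y u)).trans ?_
      rw [mul_assoc]
      exact mul_le_mul_of_nonneg_left (hyb s u le_rfl hsu hut) hM0
    · refine (hQ u hum t htm).trans ?_
      exact mul_le_mul_of_nonneg_left (mono (2*β) (by linarith) u t hsu hut le_rfl) hQ0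
    · rw [← Real.rpow_add_of_nonneg hd0 (by linarith) (by linarith)]
      exact aux_pow _ _ _ (by linarith) (by linarith) (by linarith) hd0 hd2
    · rw [← Real.rpow_add_of_nonneg hd0 (by linarith) (by linarith)]
      congr 1; ring
  obtain ⟨J, hJ⟩ := hsew Ξ K hK0 hΞc hΞ0 hδ
  have hinc : ∀ s t, 0 ≤ s → s ≤ t → t ≤ 2 →
      |J t - J s| ≤ 4 * (M * L + M * Q + C * K) * (t - s) ^ β := by
    intro s t hs hst ht
    have hsm : s ∈ Icc (0:ℝ) 2 := ⟨hs, by linarith⟩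
    have htm : t ∈ Icc (0:ℝ) 2 := ⟨by linarith, by linarith⟩
    have hd0 : 0 ≤ t - s := by linarith
    have hd2 : t - s ≤ 2 := by linarith
    have p1 := aux_pow α β (t-s) hβα.le (by linarith) hβ0 hd0 hd2
    have p2 := aux_pow (2*β) β (t-s) (by linarith) (by linarith) hβ0 hd0 hd2
    have p3 := aux_pow (3*β) β (t-s) (by linarith) (by linarith) hβ0 hd0 hd2
    have h1 := hJ s t hs hst ht
    have hx' := hxL s hsm t htm
    have hA' := hQ s hsm t htm
    rw [abs_of_nonneg hd0] at hx' hA'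
    have hσ' : |(σ (y s) + σ (y t)) / 2| ≤ M := by
      have a1 := (hM (y s)).1
      have a2 := (hM (y t)).1
      rw [abs_le] at *
      constructor <;> linarith [a1.1, a1.2, a2.1, a2.2]
    have b1 : |(σ (y s) + σ (y t)) / 2 * (x t - x s)| ≤ M * (L * (4 * (t-s)^β)) := by
      rw [abs_mul]
      refine mul_le_mul hσ' (hx'.trans ?_) (abs_nonneg _) hM0
      gcongr
    have b2 : |deriv σ (y s) * A s t| ≤ M * (Q * (4 * (t-s)^β)) := by
      rw [abs_mul]
      refine mul_le_mul (hM (y s)).2.1 (hA'.trans ?_) (abs_nonneg _) hM0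
      gcongr
    have b3 : C * K * (t - s) ^ (3 * β) ≤ C * K * (4 * (t-s)^β) := by gcongr
    have b4 : |J t - J s - ((σ (y s) + σ (y t)) / 2 * (x t - x s) + deriv σ (y s) * A s t)|
      ≤ C * K * (t - s) ^ (3 * β) := h1
    rw [abs_le] at b1 b2 b4 ⊢
    constructor <;> linarith [b1.1, b1.2, b2.1, b2.2, b4.1, b4.2]
  have hJc : ContinuousOn J (Icc 0 2) := by
    refine aux_contOn β (4 * (M * L + M * Q + C * K)) hβ0 J ?_
    intro s hs t ht
    rcases le_total s t with h | h
    · rw [abs_of_nonneg (sub_nonneg.2 h)]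
      exact hinc s t hs.1 h ht.2
    · rw [abs_sub_comm, abs_sub_comm t s, abs_of_nonneg (sub_nonneg.2 h)]
      exact hinc t s ht.1 h hs.2
  refine ⟨fun t => J t - J 0, ?_, ?_⟩
  · intro t ht
    have hlim := aux_limit Ξ J (C * K) (3 * β) (by linarith) (by positivity) hΞc hJc hJ t ht.1 ht.2
    refine hlim.congr' ?_
    filter_upwards [Ioc_mem_nhdsGT (show (0:ℝ) < 1 by norm_num)] with ε hε
    have hmap : MapsTo (fun u : ℝ => (u, u + ε)) (Icc 0 t) (Icc (0:ℝ) 2 ×ˢ Icc (0:ℝ) 2) := by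
      intro u hu
      exact ⟨⟨hu.1, by linarith [hu.2, ht.2]⟩,
        ⟨by linarith [hu.1, hε.1], by linarith [hu.2, hε.2, ht.2]⟩⟩
    have i1 : IntervalIntegrable (fun u => (σ (y u) + σ (y (u+ε))) / 2 * (x (u+ε) - x u))
        volume 0 t := by
      apply ContinuousOn.intervalIntegrable
      rw [uIcc_of_le ht.1]
      exact hT1.comp (f := fun u : ℝ => (u, u + ε)) (by fun_prop) hmap
    have i2 : IntervalIntegrable (fun u => deriv σ (y u) * A u (u+ε)) volume 0 t := by
      apply ContinuousOn.intervalIntegrable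
      rw [uIcc_of_le ht.1]
      exact hT2.comp (f := fun u : ℝ => (u, u + ε)) (by fun_prop) hmap
    simp only [Ieps, Ξ]
    rw [intervalIntegral.integral_add i1 i2, mul_add]
  · intro s t hs hst ht
    have hd0 : 0 ≤ t - s := by linarith
    have hbi : ∀ v w, 0 ≤ v → v ≤ w → w ≤ 1 →
        IntervalIntegrable (fun u => b (y u)) volume v w := by
      intro v w h1 h2 h3
      apply ContinuousOn.intervalIntegrable
      rw [uIcc_of_le h2]
      exact hKb.continuous.comp_continuousOn
        (hyc.mono (Icc_subset_Icc h1 (by linarith)))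
    have hsplit := intervalIntegral.integral_add_adjacent_intervals
      (hbi 0 s le_rfl hs (by linarith)) (hbi s t hs hst ht)
    have hb := intervalIntegral.norm_integral_le_of_norm_le_const (a := s) (b := t)
      (f := fun u => b (y u)) (C := B) (fun u _ => hB (y u))
    rw [Real.norm_eq_abs, abs_of_nonneg hd0] at hb
    have p1 := aux_pow 1 β (t-s) (by linarith) (by linarith) hβ0 hd0 (by linarith)
    rw [Real.rpow_one] at p1
    have hb' : |∫ u in s..t, b (y u)| ≤ 4 * B * (t - s) ^ β := by
      refine hb.trans ?_
      have := mul_le_mul_of_nonneg_left p1 hB0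
      linarith
    have hi := hinc s t hs hst (by linarith)
    have hD : 0 ≤ (t - s) ^ β := by positivity
    have e : ((J t - J 0) + ∫ w in (0:ℝ)..t, b (y w)) - ((J s - J 0) + ∫ w in (0:ℝ)..s, b (y w))
        = (J t - J s) + ∫ u in s..t, b (y u) := by
      rw [← hsplit]; ring
    calc _ = |(J t - J s) + ∫ u in s..t, b (y u)| := by rw [← e]
      _ ≤ |J t - J s| + |∫ u in s..t, b (y u)| := abs_add_le _ _
      _ ≤ (4 * (M * L + M * Q + C * K) + 4 * B) * (t - s) ^ β := by linarith
      _ ≤ _ := by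
        apply mul_le_mul_of_nonneg_right _ hD
        have q0 : 0 ≤ N * Q := mul_nonneg hN0 hQ0
        have q1 : 0 ≤ N ^ 2 := sq_nonneg N
        set Z := 1 + N + N ^ 2 + N * Q + Q with hZ
        have z1 : 1 ≤ Z := by linarith
        have z2 : Q ≤ Z := by linarith
        have z3 : N ^ 2 ≤ Z := by linarith
        have z4 : N * Q ≤ Z := by linarith
        have r1 := mul_le_mul_of_nonneg_left z1 (mul_nonneg hM0 hL.le)
        have r2 := mul_le_mul_of_nonneg_left z2 hM0
        have r3 := mul_le_mul_of_nonneg_left z3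
          (mul_nonneg hC0 (mul_nonneg (mul_nonneg (by norm_num : (0:ℝ) ≤ 8) hM0) hL.le))
        have r4 := mul_le_mul_of_nonneg_left z4 (mul_nonneg hC0 hM0)
        have r5 := mul_le_mul_of_nonneg_left z1 hB0
        rw [hK]
        linarith
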